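/- For any 1-rounding of G_α: if the knob c_{j,t} is connected by a clause-variable edge to a base vertex of the variable gadget for x_i, then the handle e(c_{j,t}) is rounded in the same direction (up or down) as the edge e(v_{i,0}); if c_{j,t} is connected by a clause-variable edge to an inverter vertex of the variable gadget for x_i, then e(c_{j,t}) is rounded in the opposite direction to e(v_{i,0}). -/

import Mathlib

open SimpleGraph

/-! ## Generic shortest-path and rounding definitions -/

noncomputable def wWeight {V : Type*} {G : SimpleGraph V} (w : V → V → ℝ) {u v : V}
    (p : G.Walk u v) : ℝ :=
  (p.darts.map (fun d => w d.toProd.1 d.toProd.2)).sum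

def IsShortestPath {V : Type*} {G : SimpleGraph V} (w : V → V → ℝ) {u v : V}
    (p : G.Walk u v) : Prop :=
  p.IsPath ∧ ∀ q : G.Walk u v, wWeight w p ≤ wWeight w q

def PathObliviousRounding {V : Type*} (G : SimpleGraph V) (w : V → V → ℝ) (wt : V → V → ℕ)
    (ε : ℝ) : Prop :=
  ∀ (u v : V) (p : G.Walk u v), IsShortestPath w p →
    |wWeight (fun a b => (wt a b : ℝ)) p - wWeight w p| < ε

def WeakRounding {V : Type*} (G : SimpleGraph V) (w : V → V → ℝ) (wt : V → V → ℕ)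
    (ε : ℝ) : Prop :=
  PathObliviousRounding G w wt ε ∧
  ∀ (u v : V) (p : G.Walk u v), IsShortestPath w p →
    IsShortestPath (fun a b => (wt a b : ℝ)) p

def StrongRounding {V : Type*} (G : SimpleGraph V) (w : V → V → ℝ) (wt : V → V → ℕ)
    (ε : ℝ) : Prop :=
  WeakRounding G w wt ε ∧
  ∀ (u v : V) (p : G.Walk u v), IsShortestPath (fun a b => (wt a b : ℝ)) p →
    IsShortestPath w p

/-! ## The construction of `G_α`

A 3-CNF formula `α` with `m` clauses over `n` variables is given by
`C : Fin m → Fin 3 → Fin n × Bool`: the `t`-th literal of clause `j` is the variable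
`(C j t).1` with polarity `(C j t).2` (`true` = positive literal, `false` = negated). -/

variable {n m : ℕ}

/-- The occurrences of variable `i` in `α`, as the lexicographically ordered list of
pairs `(j, t)` such that the `t`-th literal of clause `j` involves `x_i`. -/
def occs (C : Fin m → Fin 3 → Fin n × Bool) (i : Fin n) : List (Fin m × Fin 3) :=
  ((List.finRange m).product (List.finRange 3)).filter (fun q => (C q.1 q.2).1 = i)

/-- The number `h` of literals of `α` involving variable `i`. -/
def hocc (C : Fin m → Fin 3 → Fin n × Bool) (i : Fin n) : ℕ := (occs C i).length

/-- The vertices of the variable gadget for `x_i`: for each occurrence `k` a triangle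
`Δ_{i,k}` with left (`0`), right (`1`) and base (`2`) vertex; two pendant vertices
(`false` = `v_{i,0}`, `true` = `v_{i,h+1}`); and an inverter vertex for each negated
occurrence. -/
def VarV (C : Fin m → Fin 3 → Fin n × Bool) (i : Fin n) : Type :=
  (Fin (hocc C i) × Fin 3) ⊕
    (Bool ⊕ {k : Fin (hocc C i) //
      (C ((occs C i).get k).1 ((occs C i).get k).2).2 = false})

/-- The vertices of the clause gadget for `C_j`: a nine-cycle, three knobs, and a centre. -/
def ClauseV : Type := (Fin 9 ⊕ Fin 3) ⊕ Unit

/-- The vertex set of `G_α`. -/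
def GV (C : Fin m → Fin 3 → Fin n × Bool) : Type :=
  (Σ i : Fin n, VarV C i) ⊕ (Fin m × ClauseV)

def vtri (C : Fin m → Fin 3 → Fin n × Bool) (i : Fin n) (k : Fin (hocc C i)) (x : Fin 3) :
    GV C := Sum.inl ⟨i, Sum.inl (k, x)⟩

def vpend (C : Fin m → Fin 3 → Fin n × Bool) (i : Fin n) (b : Bool) : GV C :=
  Sum.inl ⟨i, Sum.inr (Sum.inl b)⟩

def vinv (C : Fin m → Fin 3 → Fin n × Bool) (i : Fin n) (k : Fin (hocc C i))
    (hk : (C ((occs C i).get k).1 ((occs C i).get k).2).2 = false) : GV C :=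
  Sum.inl ⟨i, Sum.inr (Sum.inr ⟨k, hk⟩)⟩

def ccyc (C : Fin m → Fin 3 → Fin n × Bool) (j : Fin m) (s : Fin 9) : GV C :=
  Sum.inr (j, Sum.inl (Sum.inl s))

def cknob (C : Fin m → Fin 3 → Fin n × Bool) (j : Fin m) (t : Fin 3) : GV C :=
  Sum.inr (j, Sum.inl (Sum.inr t))

def cctr (C : Fin m → Fin 3 → Fin n × Bool) (j : Fin m) : GV C := Sum.inr (j, Sum.inr ())

/-- The edges of weight `2.5` inside the variable gadgets: triangle edges, chain edges,
the two pendant edges, and inverter edges. -/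
def varRel (C : Fin m → Fin 3 → Fin n × Bool) (a b : GV C) : Prop :=
  (∃ (i : Fin n) (k : Fin (hocc C i)) (x y : Fin 3),
      x ≠ y ∧ a = vtri C i k x ∧ b = vtri C i k y) ∨
  (∃ (i : Fin n) (k k' : Fin (hocc C i)),
      k'.val = k.val + 1 ∧ a = vtri C i k 1 ∧ b = vtri C i k' 0) ∨
  (∃ (i : Fin n) (k : Fin (hocc C i)), k.val = 0 ∧ a = vpend C i false ∧ b = vtri C i k 0) ∨
  (∃ (i : Fin n) (k : Fin (hocc C i)),
      k.val + 1 = hocc C i ∧ a = vpend C i true ∧ b = vtri C i k 1) ∨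
  (∃ (i : Fin n) (k : Fin (hocc C i))
      (hk : (C ((occs C i).get k).1 ((occs C i).get k).2).2 = false),
      a = vinv C i k hk ∧ b = vtri C i k 2)

/-- The handle edges, of weight `2.5`: knob `c_{j,t}` is attached to cycle vertex `3t`. -/
def handleRel (C : Fin m → Fin 3 → Fin n × Bool) (a b : GV C) : Prop :=
  ∃ (j : Fin m) (t : Fin 3), a = cknob C j t ∧ b = ccyc C j ⟨3 * t.val, by omega⟩

/-- The nonagon edges, of weight `3.6`. -/
def cycleRel (C : Fin m → Fin 3 → Fin n × Bool) (a b : GV C) : Prop :=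
  ∃ (j : Fin m) (s : Fin 9), a = ccyc C j s ∧ b = ccyc C j (s + 1)

/-- The centre edges, of weight `6`. -/
def centreRel (C : Fin m → Fin 3 → Fin n × Bool) (a b : GV C) : Prop :=
  ∃ (j : Fin m) (s : Fin 9), a = cctr C j ∧ b = ccyc C j s

/-- The clause-variable edges, of weight `D`: the knob `c_{j,t}` is joined to the base
vertex of the triangle of the corresponding occurrence of the variable `(C j t).1` if the
literal is positive, and to the inverter of that triangle if the literal is negated. -/
def cvRel (C : Fin m → Fin 3 → Fin n × Bool) (a b : GV C) : Prop :=
  ∃ (j : Fin m) (t : Fin 3) (k : Fin (hocc C (C j t).1)),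
    (occs C (C j t).1).get k = (j, t) ∧ a = cknob C j t ∧
    ((∃ (hk : (C ((occs C (C j t).1).get k).1 ((occs C (C j t).1).get k).2).2 = false),
        b = vinv C (C j t).1 k hk) ∨
      ((C j t).2 = true ∧ b = vtri C (C j t).1 k 2))

/-- The shortcut edges, of weight `2D`: between vertices of different variable gadgets, of
different clause gadgets, or of a variable gadget and a clause gadget not involving that
variable. -/
def shortRel (C : Fin m → Fin 3 → Fin n × Bool) (a b : GV C) : Prop :=
  (∃ (i i' : Fin n) (x : VarV C i) (y : VarV C i'),
      i ≠ i' ∧ a = Sum.inl ⟨i, x⟩ ∧ b = Sum.inl ⟨i', y⟩) ∨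
  (∃ (j j' : Fin m) (x y : ClauseV),
      j ≠ j' ∧ a = Sum.inr (j, x) ∧ b = Sum.inr (j', y)) ∨
  (∃ (i : Fin n) (x : VarV C i) (j : Fin m) (y : ClauseV), (∀ t, (C j t).1 ≠ i) ∧
      a = Sum.inl ⟨i, x⟩ ∧ b = Sum.inr (j, y))

/-- The graph `G_α`. -/
def Galpha (C : Fin m → Fin 3 → Fin n × Bool) : SimpleGraph (GV C) :=
  SimpleGraph.fromRel (fun a b =>
    varRel C a b ∨ handleRel C a b ∨ cycleRel C a b ∨ centreRel C a b ∨
    cvRel C a b ∨ shortRel C a b)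

open Classical in
/-- The weight function of `G_α`, with `D = 5m + 20`. -/
noncomputable def ωα (C : Fin m → Fin 3 → Fin n × Bool) : GV C → GV C → ℝ := fun a b =>
  if varRel C a b ∨ varRel C b a ∨ handleRel C a b ∨ handleRel C b a then 2.5
  else if cycleRel C a b ∨ cycleRel C b a then 3.6
  else if centreRel C a b ∨ centreRel C b a then 6
  else if cvRel C a b ∨ cvRel C b a then 5 * m + 20
  else if shortRel C a b ∨ shortRel C b a then 2 * (5 * m + 20)
  else 0

/-- The assignment `ψ` satisfies the formula: each clause has a true literal. -/
def Satisfies (C : Fin m → Fin 3 → Fin n × Bool) (ψ : Fin n → Bool) : Prop :=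
  ∀ j : Fin m, ∃ t : Fin 3, (if (C j t).2 then ψ (C j t).1 else !(ψ (C j t).1)) = true

/-- Each variable appears at most once per clause. -/
def DistinctVars (C : Fin m → Fin 3 → Fin n × Bool) : Prop :=
  ∀ (j : Fin m) (t t' : Fin 3), (C j t).1 = (C j t').1 → t = t'

/-! ## Shortest paths certified by potentials -/

theorem sub_le_wWeight_of_potential {V : Type*} {G : SimpleGraph V} {w : V → V → ℝ} (f : V → ℝ)
    (hf : ∀ a b, G.Adj a b → f b - f a ≤ w a b) {u v : V} (p : G.Walk u v) :
    f v - f u ≤ wWeight w p := by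
  induction p with
  | nil => simp [wWeight]
  | cons h p ih =>
    have h1 := hf _ _ h
    simp only [wWeight, Walk.darts_cons, List.map_cons, List.sum_cons] at ih ⊢
    linarith

theorem isShortestPath_of_potential {V : Type*} {G : SimpleGraph V} {w : V → V → ℝ} (f : V → ℝ)
    (hf : ∀ a b, G.Adj a b → f b - f a ≤ w a b) {u v : V} (p : G.Walk u v) (hp : p.IsPath)
    (hle : wWeight w p ≤ f v - f u) : IsShortestPath w p :=
  ⟨hp, fun q => hle.trans (sub_le_wWeight_of_potential f hf q)⟩

theorem eq_two_or_three_of_abs_sub_lt {a : ℕ} (h : |(a : ℝ) - 2.5| < 1) : a = 2 ∨ a = 3 := by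
  rw [abs_lt] at h
  have h1 : (1 : ℝ) < a := by linarith [h.1]
  have h2 : (a : ℝ) < 4 := by linarith [h.2]
  have h3 : 1 < a := by exact_mod_cast h1
  have h4 : a < 4 := by exact_mod_cast h2
  omega

/-! ## Edges and weights of `G_α` -/

/-- The gadget containing a vertex. -/
def gadget (C : Fin m → Fin 3 → Fin n × Bool) : GV C → Fin n ⊕ Fin m
  | Sum.inl x => Sum.inl x.1
  | Sum.inr x => Sum.inr x.1

variable {C : Fin m → Fin 3 → Fin n × Bool}

theorem varRel.gadget_eq {a b : GV C} (h : varRel C a b) : gadget C a = gadget C b := by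
  rcases h with ⟨i, k, x, y, -, rfl, rfl⟩ | ⟨i, k, k', -, rfl, rfl⟩ | ⟨i, k, -, rfl, rfl⟩ |
    ⟨i, k, -, rfl, rfl⟩ | ⟨i, k, hk, rfl, rfl⟩ <;> rfl

theorem handleRel.gadget_eq {a b : GV C} (h : handleRel C a b) : gadget C a = gadget C b := by
  obtain ⟨j, t, rfl, rfl⟩ := h; rfl

theorem cycleRel.gadget_eq {a b : GV C} (h : cycleRel C a b) : gadget C a = gadget C b := by
  obtain ⟨j, t, rfl, rfl⟩ := h; rfl

theorem centreRel.gadget_eq {a b : GV C} (h : centreRel C a b) : gadget C a = gadget C b := by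
  obtain ⟨j, t, rfl, rfl⟩ := h; rfl

theorem cvRel.gadget_ne {a b : GV C} (h : cvRel C a b) : gadget C a ≠ gadget C b := by
  obtain ⟨j, t, k, -, rfl, ⟨hk, rfl⟩ | ⟨-, rfl⟩⟩ := h <;> simp [gadget, cknob, vinv, vtri]

/-- The pair `a`, `b` is an edge of weight `2.5`. -/
def HalfEdge (C : Fin m → Fin 3 → Fin n × Bool) (a b : GV C) : Prop :=
  (Galpha C).Adj a b ∧ ωα C a b = 2.5

theorem HalfEdge.of_varRel {a b : GV C} (h : varRel C a b) (hne : a ≠ b) : HalfEdge C a b :=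
  ⟨(SimpleGraph.fromRel_adj _ _ _).2 ⟨hne, Or.inl (Or.inl h)⟩, by simp [ωα, h]⟩

theorem HalfEdge.of_varRel_symm {a b : GV C} (h : varRel C b a) (hne : a ≠ b) : HalfEdge C a b :=
  ⟨(SimpleGraph.fromRel_adj _ _ _).2 ⟨hne, Or.inr (Or.inl h)⟩, by simp [ωα, h]⟩

/-- The role of a vertex inside its gadget, and the index of its triangle. -/
def role (C : Fin m → Fin 3 → Fin n × Bool) : GV C → ℕ × ℕ
  | Sum.inl ⟨_, Sum.inl (k, x)⟩ => (x.val, k.val)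
  | Sum.inl ⟨_, Sum.inr (Sum.inl b)⟩ => (if b then 3 else 4, 0)
  | Sum.inl ⟨_, Sum.inr (Sum.inr k)⟩ => (5, k.1.val)
  | Sum.inr _ => (6, 0)

theorem halfEdge_tri (i : Fin n) (k : Fin (hocc C i)) {x y : Fin 3} (h : x ≠ y) :
    HalfEdge C (vtri C i k x) (vtri C i k y) := by
  refine .of_varRel (Or.inl ⟨i, k, x, y, h, rfl, rfl⟩) fun he => h ?_
  have := congrArg (role C) he
  simpa [role, vtri, Fin.ext_iff] using this

theorem halfEdge_link (i : Fin n) {k k' : Fin (hocc C i)} (h : k'.val = k.val + 1) :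
    HalfEdge C (vtri C i k 1) (vtri C i k' 0) := by
  refine .of_varRel (Or.inr (Or.inl ⟨i, k, k', h, rfl, rfl⟩)) fun he => ?_
  have := congrArg (role C) he
  simp [role, vtri] at this

theorem halfEdge_pend (i : Fin n) {k : Fin (hocc C i)} (h : k.val = 0) :
    HalfEdge C (vpend C i false) (vtri C i k 0) := by
  refine .of_varRel (Or.inr (Or.inr (Or.inl ⟨i, k, h, rfl, rfl⟩))) fun he => ?_
  have := congrArg (role C) he
  simp [role, vtri, vpend] at this

theorem halfEdge_inv (i : Fin n) {k : Fin (hocc C i)}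
    (hk : (C ((occs C i).get k).1 ((occs C i).get k).2).2 = false) :
    HalfEdge C (vtri C i k 2) (vinv C i k hk) := by
  refine .of_varRel_symm
    (Or.inr (Or.inr (Or.inr (Or.inr ⟨i, k, hk, rfl, rfl⟩)))) fun he => ?_
  have := congrArg (role C) he
  simp [role, vtri, vinv] at this

theorem halfEdge_handle (j : Fin m) (t : Fin 3) :
    HalfEdge C (cknob C j t) (ccyc C j ⟨3 * t.val, by omega⟩) := by
  have h : handleRel C (cknob C j t) (ccyc C j ⟨3 * t.val, by omega⟩) := ⟨j, t, rfl, rfl⟩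
  refine ⟨(SimpleGraph.fromRel_adj _ _ _).2 ⟨fun he => ?_, Or.inl (Or.inr (Or.inl h))⟩,
    by simp [ωα, h]⟩
  have := congrArg Prod.snd (Sum.inr.inj he)
  simpa using Sum.inl.inj this

theorem ωα_of_cvRel {a b : GV C} (h : cvRel C a b ∨ cvRel C b a) : ωα C a b = 5 * m + 20 := by
  have hne : gadget C a ≠ gadget C b := h.elim (·.gadget_ne) (·.gadget_ne.symm)
  have h1 : ¬ (varRel C a b ∨ varRel C b a ∨ handleRel C a b ∨ handleRel C b a) := by
    rintro (h | h | h | h)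
    exacts [hne h.gadget_eq, hne h.gadget_eq.symm, hne h.gadget_eq, hne h.gadget_eq.symm]
  have h2 : ¬ (cycleRel C a b ∨ cycleRel C b a) := by
    rintro (h | h)
    exacts [hne h.gadget_eq, hne h.gadget_eq.symm]
  have h3 : ¬ (centreRel C a b ∨ centreRel C b a) := by
    rintro (h | h)
    exacts [hne h.gadget_eq, hne h.gadget_eq.symm]
  rw [ωα, if_neg h1, if_neg h2, if_neg h3, if_pos h]

theorem ωα_of_gadget_ne {a b : GV C} (hadj : (Galpha C).Adj a b) (hne : gadget C a ≠ gadget C b) :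
    (cvRel C a b ∨ cvRel C b a) ∨ ωα C a b = 2 * (5 * m + 20) := by
  by_cases h4 : cvRel C a b ∨ cvRel C b a
  · exact Or.inl h4
  have h1 : ¬ (varRel C a b ∨ varRel C b a ∨ handleRel C a b ∨ handleRel C b a) := by
    rintro (h | h | h | h)
    exacts [hne h.gadget_eq, hne h.gadget_eq.symm, hne h.gadget_eq, hne h.gadget_eq.symm]
  have h2 : ¬ (cycleRel C a b ∨ cycleRel C b a) := by
    rintro (h | h)
    exacts [hne h.gadget_eq, hne h.gadget_eq.symm]
  have h3 : ¬ (centreRel C a b ∨ centreRel C b a) := by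
    rintro (h | h)
    exacts [hne h.gadget_eq, hne h.gadget_eq.symm]
  have h5 : shortRel C a b ∨ shortRel C b a := by
    have := ((SimpleGraph.fromRel_adj _ _ _).1 hadj).2
    tauto
  right
  rw [ωα, if_neg h1, if_neg h2, if_neg h3, if_neg h4, if_pos h5]

theorem le_ωα {a b : GV C} (hadj : (Galpha C).Adj a b) : 2.5 ≤ ωα C a b := by
  have hm : (0 : ℝ) ≤ m := m.cast_nonneg
  have h := ((SimpleGraph.fromRel_adj _ _ _).1 hadj).2
  unfold ωα
  split_ifs
  · norm_num
  · norm_num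
  · norm_num
  · linarith
  · linarith
  · tauto

/-! ## Consequences of being a path-oblivious `1`-rounding -/


theorem HalfEdge.rounded {wt : GV C → GV C → ℕ}
    (hround : PathObliviousRounding (Galpha C) (ωα C) wt 1) {a b : GV C} (h : HalfEdge C a b) :
    wt a b = 2 ∨ wt a b = 3 := by
  classical
  have := hround _ _ h.1.toWalk (isShortestPath_of_potential (fun x => if x = a then 0 else 2.5)
    (fun x y hxy => ?_) _ ?_ ?_)
  · simp only [wWeight, Adj.toWalk, Walk.darts_cons, Walk.darts_nil, List.map_cons, List.map_nil,
      List.sum_cons, List.sum_nil, add_zero, h.2] at this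
    exact eq_two_or_three_of_abs_sub_lt this
  · have := le_ωα hxy
    split_ifs <;> linarith
  · simp [h.1.ne]
  · simp [wWeight, h.2, h.1.ne.symm]

/-- Two incident half-integral edges forming an induced path are rounded in opposite directions. -/
theorem HalfEdge.add_eq_five {wt : GV C → GV C → ℕ}
    (hround : PathObliviousRounding (Galpha C) (ωα C) wt 1) {u v w : GV C}
    (h : HalfEdge C u v) (h' : HalfEdge C v w) (hne : u ≠ w) (hadj : ¬ (Galpha C).Adj u w) :
    wt u v + wt v w = 5 := by
  classical
  have key := hround _ _ (Walk.cons h.1 h'.1.toWalk)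
    (isShortestPath_of_potential (fun x => if x = u then 0 else if x = w then 5 else 2.5)
    (fun x y hxy => ?_) _ ?_ ?_)
  · simp only [wWeight, Adj.toWalk, Walk.darts_cons, Walk.darts_nil, List.map_cons, List.map_nil,
      List.sum_cons, List.sum_nil, add_zero, h.2, h'.2] at key
    rcases h.rounded hround with h1 | h1 <;> rcases h'.rounded hround with h2 | h2 <;>
      rw [h1, h2] at key ⊢ <;> norm_num at key
  · have := le_ωα hxy
    split_ifs <;> try linarith
    exact (hadj (‹y = w› ▸ ‹x = u› ▸ hxy)).elim
  · simp [h.1.ne, h'.1.ne, hne]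
  · simp only [wWeight, Adj.toWalk, Walk.darts_cons, Walk.darts_nil, List.map_cons, List.map_nil,
      List.sum_cons, List.sum_nil, add_zero, h.2, h'.2, hne.symm, if_true, if_false]
    norm_num

/-! ## Variable gadgets -/

theorem varRel_of_adj {i : Fin n} {a b : GV C} (ha : gadget C a = Sum.inl i)
    (hb : gadget C b = Sum.inl i) (h : (Galpha C).Adj a b) : varRel C a b ∨ varRel C b a := by
  have key : ∀ a b : GV C, gadget C a = Sum.inl i → gadget C b = Sum.inl i →
      (varRel C a b ∨ handleRel C a b ∨ cycleRel C a b ∨ centreRel C a b ∨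
        cvRel C a b ∨ shortRel C a b) → varRel C a b := by
    rintro a b ha hb (h | ⟨j, t, rfl, rfl⟩ | ⟨j, t, rfl, rfl⟩ | ⟨j, t, rfl, rfl⟩ | h |
      ⟨i, i', x, y, hne, rfl, rfl⟩ | ⟨j, j', x, y, hne, rfl, rfl⟩ | ⟨i, x, j, y, hne, rfl, rfl⟩)
    · exact h
    · exact absurd ha (by simp [gadget, cknob])
    · exact absurd ha (by simp [gadget, ccyc])
    · exact absurd ha (by simp [gadget, cctr])
    · exact absurd (ha.trans hb.symm) h.gadget_ne
    · exact absurd (Sum.inl.inj (ha.trans hb.symm)) hne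
    · exact absurd ha (by simp [gadget])
    · exact absurd hb (by simp [gadget])
  exact ((SimpleGraph.fromRel_adj _ _ _).1 h).2.imp (key a b ha hb) (key b a hb ha)

theorem varRel.role_cases {a b : GV C} (h : varRel C a b) :
    ((role C a).1 < 3 ∧ (role C b).1 < 3 ∧ (role C a).2 = (role C b).2) ∨
    ((role C a).1 = 1 ∧ (role C b).1 = 0) ∨
    ((role C a).1 = 4 ∧ (role C b).1 = 0) ∨
    ((role C a).1 = 3 ∧ (role C b).1 = 1) ∨
    ((role C a).1 = 5 ∧ (role C b).1 = 2) := by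
  rcases h with ⟨i, k, x, y, -, rfl, rfl⟩ | ⟨i, k, k', -, rfl, rfl⟩ | ⟨i, k, -, rfl, rfl⟩ |
    ⟨i, k, -, rfl, rfl⟩ | ⟨i, k, hk, rfl, rfl⟩ <;> simp [role, vtri, vpend, vinv]

theorem wt_left {wt : GV C → GV C → ℕ} (hround : PathObliviousRounding (Galpha C) (ωα C) wt 1)
    {i : Fin n} (hpos : 0 < hocc C i) {k : ℕ} (hk : k < hocc C i) {x : Fin 3} (hx : x ≠ 0) :
    wt (vpend C i false) (vtri C i ⟨0, hpos⟩ 0) +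
      wt (vtri C i ⟨k, hk⟩ 0) (vtri C i ⟨k, hk⟩ x) = 5 := by
  have hx' : x.val ≠ 0 := fun h => hx (Fin.ext h)
  have hx3 := x.isLt
  induction k generalizing x with
  | zero =>
    refine (halfEdge_pend i rfl).add_eq_five hround (halfEdge_tri i _ hx.symm) (fun h => ?_)
      fun h => ?_
    · have := congrArg (role C) h
      simp [role, vpend, vtri] at this
      omega
    · rcases varRel_of_adj rfl rfl h with h | h <;> have := h.role_cases <;>
        simp [role, vpend, vtri] at this <;> omega
  | succ k ih =>
    have hk' : k < hocc C i := by omega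
    have hlink : HalfEdge C (vtri C i ⟨k, hk'⟩ 1) (vtri C i ⟨k + 1, hk⟩ 0) := halfEdge_link i rfl
    have h1 := ih hk' (x := 1) (by decide) (by decide) (by decide)
    have h2 := (halfEdge_tri i ⟨k, hk'⟩ (x := 0) (y := 1) (by decide)).add_eq_five hround hlink
      (fun h => ?_) fun h => ?_
    have h3 := hlink.add_eq_five hround (halfEdge_tri i _ hx.symm) (fun h => ?_) fun h => ?_
    · omega
    · have := congrArg (role C) h
      simp [role, vtri] at this
    · rcases varRel_of_adj rfl rfl h with h | h <;> have := h.role_cases <;>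
        simp [role, vtri] at this <;> omega
    · have := congrArg (role C) h
      simp [role, vtri] at this
    · rcases varRel_of_adj rfl rfl h with h | h <;> have := h.role_cases <;>
        simp [role, vtri] at this

/-! ## Crossing a clause-variable edge -/

theorem add_handle_eq_five (hdist : DistinctVars C) {wt : GV C → GV C → ℕ}
    (hround : PathObliviousRounding (Galpha C) (ωα C) wt 1) {j : Fin m} {t : Fin 3} {p q : GV C}
    (hcv : cvRel C (cknob C j t) p) (huniq : ∀ b, cvRel C (cknob C j t) b → b = p)
    (hpq : HalfEdge C q p) (hp : gadget C p = Sum.inl (C j t).1)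
    (hq : gadget C q = Sum.inl (C j t).1) :
    wt q p + wt (cknob C j t) (ccyc C j ⟨3 * t.val, by omega⟩) = 5 := by
  classical
  have hm : (0 : ℝ) ≤ m := m.cast_nonneg
  set f : GV C → ℝ := fun x =>
    if gadget C x = Sum.inl (C j t).1 then (if x = p then 2.5 else 0)
    else if gadget C x = Sum.inr j then (if x = cknob C j t then 5 * m + 22.5 else 5 * m + 25)
    else 5 * m + 20 with hf
  have hbound : ∀ x, 0 ≤ f x ∧ f x ≤ 5 * m + 25 := by
    intro x
    simp only [hf]
    split_ifs <;> constructor <;> linarith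
  have hcross : ∀ a b, cvRel C a b → |f b - f a| ≤ 5 * m + 20 := by
    intro a b h
    have h0 := h
    obtain ⟨j', t', k, hk, rfl, hb⟩ := h
    have hgb : gadget C b = Sum.inl (C j' t').1 := by
      obtain ⟨hk, rfl⟩ | ⟨-, rfl⟩ := hb <;> rfl
    have hga : gadget C (cknob C j' t') = Sum.inr j' := rfl
    by_cases hj : j' = j
    · subst hj
      by_cases hi : (C j' t').1 = (C j' t).1
      · obtain rfl := hdist j' t' t hi
        obtain rfl := huniq b h0
        simp only [hf, hga, hgb, if_true, reduceCtorEq, if_false]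
        rw [abs_le]; constructor <;> linarith
      · simp only [hf, hga, hgb, Sum.inl.injEq, hi, if_true, reduceCtorEq, if_false]
        split_ifs <;> rw [abs_le] <;> constructor <;> linarith
    · simp only [hf, hga, hgb, Sum.inr.injEq, hj, reduceCtorEq, if_false]
      split_ifs <;> rw [abs_le] <;> constructor <;> linarith
  have hlip : ∀ a b, (Galpha C).Adj a b → f b - f a ≤ ωα C a b := by
    intro a b hab
    by_cases hne : gadget C a = gadget C b
    · refine le_trans ?_ (le_ωα hab)
      simp only [hf, hne]
      split_ifs <;> linarith
    · rcases ωα_of_gadget_ne hab hne with h | h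
      · rw [ωα_of_cvRel h]
        rcases h with h | h
        · exact (le_abs_self _).trans (hcross a b h)
        · exact (le_abs_self _).trans ((abs_sub_comm _ _).trans_le (hcross b a h))
      · rw [h]
        linarith [(hbound a).1, (hbound b).2]
  have hadj : (Galpha C).Adj p (cknob C j t) := by
    refine (SimpleGraph.fromRel_adj _ _ _).2 ⟨fun h => hcv.gadget_ne (h ▸ rfl), Or.inr ?_⟩
    tauto
  have hw : ωα C p (cknob C j t) = 5 * m + 20 := ωα_of_cvRel (Or.inr hcv)
  have hh := halfEdge_handle (C := C) j t
  have hgk : gadget C (cknob C j t) = Sum.inr j := rfl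
  have hgc : gadget C (ccyc C j ⟨3 * t.val, by omega⟩) = Sum.inr j := rfl
  have hfp : f p = 2.5 := by simp [hf, hp]
  have hfq : f q = 0 := by simp [hf, hq, hpq.1.ne]
  have hfk : f (cknob C j t) = 5 * m + 22.5 := by simp [hf, hgk]
  have hfc : f (ccyc C j ⟨3 * t.val, by omega⟩) = 5 * m + 25 := by simp [hf, hgc, hh.1.ne.symm]
  have h1 := hround _ _ hadj.toWalk (isShortestPath_of_potential f hlip _ (by simp [hadj.ne]) (by
    simp only [wWeight, Adj.toWalk, Walk.darts_cons, Walk.darts_nil, List.map_cons, List.map_nil,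
      List.sum_cons, List.sum_nil, hw, hfp, hfk]
    linarith))
  have h2 := hround _ _ (Walk.cons hpq.1 (Walk.cons hadj hh.1.toWalk))
    (isShortestPath_of_potential f hlip _ ?_ (by
    simp only [wWeight, Adj.toWalk, Walk.darts_cons, Walk.darts_nil, List.map_cons, List.map_nil,
      List.sum_cons, List.sum_nil, hw, hpq.2, hh.2, hfq, hfc]
    linarith))
  · simp only [wWeight, Adj.toWalk, Walk.darts_cons, Walk.darts_nil, List.map_cons, List.map_nil,
      List.sum_cons, List.sum_nil, add_zero, hw, hpq.2, hh.2] at h1 h2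
    have hexact : wt p (cknob C j t) = 5 * m + 20 := by
      have h3 : |((wt p (cknob C j t) : ℤ) - (5 * m + 20 : ℤ))| < 1 := by exact_mod_cast h1
      have := Int.abs_lt_one_iff.1 h3
      omega
    rw [hexact] at h2
    push_cast at h2
    rcases hpq.rounded hround with h3 | h3 <;> rcases hh.rounded hround with h4 | h4 <;>
      rw [h3, h4] at h2 ⊢ <;> rw [abs_lt] at h2 <;> norm_num at h2 <;> linarith [h2.1, h2.2]
  · have e1 : q ≠ cknob C j t := fun h => by rw [h, hgk] at hq; simp at hq
    have e2 : q ≠ ccyc C j ⟨3 * t.val, by omega⟩ := fun h => by rw [h, hgc] at hq; simp at hq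
    have e3 : p ≠ ccyc C j ⟨3 * t.val, by omega⟩ := fun h => by rw [h, hgc] at hp; simp at hp
    simp [hpq.1.ne, hadj.ne, hh.1.ne, e1, e2, e3]

theorem occs_nodup (C : Fin m → Fin 3 → Fin n × Bool) (i : Fin n) : (occs C i).Nodup :=
  ((List.nodup_finRange m).product (List.nodup_finRange 3)).filter _

theorem exists_occs_get_eq (C : Fin m → Fin 3 → Fin n × Bool) (j : Fin m) (t : Fin 3) :
    ∃ k : Fin (hocc C (C j t).1), (occs C (C j t).1).get k = (j, t) := by
  refine List.mem_iff_get.1 (List.mem_filter.2 ⟨?_, by simp⟩)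
  exact List.mem_product.2 ⟨List.mem_finRange _, List.mem_finRange _⟩

theorem cvRel_cknob {j : Fin m} {t : Fin 3} {k : Fin (hocc C (C j t).1)}
    (hk : (occs C (C j t).1).get k = (j, t)) {b : GV C} (h : cvRel C (cknob C j t) b) :
    (∃ hk : (C ((occs C (C j t).1).get k).1 ((occs C (C j t).1).get k).2).2 = false,
        b = vinv C (C j t).1 k hk) ∨
      ((C j t).2 = true ∧ b = vtri C (C j t).1 k 2) := by
  obtain ⟨j', t', k', hk', hjt, hb⟩ := h
  obtain ⟨rfl, ht⟩ := Prod.mk.inj (Sum.inr.inj hjt)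
  obtain rfl := Sum.inr.inj (Sum.inl.inj ht)
  obtain rfl : k' = k := List.nodup_iff_injective_get.1 (occs_nodup C _) (hk'.trans hk.symm)
  exact hb

/-- For any path-oblivious `1`-rounding of `G_α`: if the knob `c_{j,t}` is joined by its
clause-variable edge to a base vertex of the variable gadget for `x_i` (i.e. the `t`-th
literal of clause `j` is the positive literal `x_i`), then the handle `e(c_{j,t})` is
rounded in the same direction as the edge `e(v_{i,0})`; if it is joined to an inverter
(i.e. the literal is `¬x_i`), then `e(c_{j,t})` is rounded in the opposite direction to
`e(v_{i,0})`.  (An edge of weight `2.5` is rounded down if its rounded weight is `2`, and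
up if it is `3`.) -/
theorem clause_variable_edge_rounding {n m : ℕ}
    (C : Fin m → Fin 3 → Fin n × Bool) (hdist : DistinctVars C)
    (wt : GV C → GV C → ℕ) (hwts : ∀ a b, wt a b = wt b a)
    (hround : PathObliviousRounding (Galpha C) (ωα C) wt 1)
    (j : Fin m) (t : Fin 3) (hpos : 0 < hocc C (C j t).1) :
    ((C j t).2 = true →
      ((wt (cknob C j t) (ccyc C j ⟨3 * t.val, by omega⟩) = 2 ∧
          wt (vpend C (C j t).1 false) (vtri C (C j t).1 ⟨0, hpos⟩ 0) = 2) ∨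
        (wt (cknob C j t) (ccyc C j ⟨3 * t.val, by omega⟩) = 3 ∧
          wt (vpend C (C j t).1 false) (vtri C (C j t).1 ⟨0, hpos⟩ 0) = 3))) ∧
    ((C j t).2 = false →
      ((wt (cknob C j t) (ccyc C j ⟨3 * t.val, by omega⟩) = 2 ∧
          wt (vpend C (C j t).1 false) (vtri C (C j t).1 ⟨0, hpos⟩ 0) = 3) ∨
        (wt (cknob C j t) (ccyc C j ⟨3 * t.val, by omega⟩) = 3 ∧
          wt (vpend C (C j t).1 false) (vtri C (C j t).1 ⟨0, hpos⟩ 0) = 2))) := by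
  obtain ⟨k, hk⟩ := exists_occs_get_eq C j t
  have hbase : wt (vpend C (C j t).1 false) (vtri C (C j t).1 ⟨0, hpos⟩ 0) +
      wt (vtri C (C j t).1 k 0) (vtri C (C j t).1 k 2) = 5 :=
    wt_left hround hpos k.isLt (by decide)
  have hpend := (halfEdge_pend (C := C) (C j t).1 (k := ⟨0, hpos⟩) rfl).rounded hround
  refine ⟨fun hpol => ?_, fun hpol => ?_⟩
  · have hcv : cvRel C (cknob C j t) (vtri C (C j t).1 k 2) :=
      ⟨j, t, k, hk, rfl, Or.inr ⟨hpol, rfl⟩⟩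
    have := add_handle_eq_five hdist hround hcv (fun b hb => ?_)
      (halfEdge_tri _ k (x := 0) (by decide)) rfl rfl
    · omega
    · rcases cvRel_cknob hk hb with ⟨h, -⟩ | ⟨-, h⟩
      · rw [hk, hpol] at h
        cases h
      · exact h
  · have hneg : (C ((occs C (C j t).1).get k).1 ((occs C (C j t).1).get k).2).2 = false := by
      rw [hk]; exact hpol
    have hcv : cvRel C (cknob C j t) (vinv C (C j t).1 k hneg) :=
      ⟨j, t, k, hk, rfl, Or.inl ⟨hneg, rfl⟩⟩
    have hinv := (halfEdge_tri (C j t).1 k (x := 0) (y := 2) (by decide)).add_eq_five hround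
      (halfEdge_inv _ hneg) (fun h => ?_) fun h => ?_
    · have := add_handle_eq_five hdist hround hcv (fun b hb => ?_) (halfEdge_inv _ hneg) rfl rfl
      · omega
      · rcases cvRel_cknob hk hb with ⟨_, h⟩ | ⟨h, -⟩
        · exact h
        · rw [hpol] at h
          cases h
    · have := congrArg (role C) h
      simp [role, vtri, vinv] at this
    · rcases varRel_of_adj rfl rfl h with h | h <;> have := h.role_cases <;>
        simp [role, vtri, vinv] at this
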